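/- arXiv:2312.02036 — 4 statements merged into one kernel-verified Lean document; each statement's English description precedes it below -/
import Mathlib

section
/- Let S be a regular ordered semigroup and let A, B be bi-ideals of S. If there exist bi-ideals X and Y of S such that A = (XB] and B = (YA], then for every a ∈ A there exists b ∈ B with (Sa] = (Sb], and for every b ∈ B there exists a ∈ A with (Sa] = (Sb]. -/
variable {S : Type*}

/-- Downward closure `(A] = {x | ∃ a ∈ A, x ≤ a}`. -/
def dcl [LE S] (A : Set S) : Set S := {x | ∃ a ∈ A, x ≤ a}

/-- Product of subsets `UV = {u·v | u ∈ U, v ∈ V}`. -/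
def setMul [Mul S] (A B : Set S) : Set S := {x | ∃ a ∈ A, ∃ b ∈ B, x = a * b}

/-- Compatibility of the order with multiplication (ordered semigroup axiom). -/
def OrdCompat (S : Type*) [Mul S] [LE S] : Prop :=
  ∀ x a b : S, a ≤ b → x * a ≤ x * b ∧ a * x ≤ b * x

/-- A bi-ideal: nonempty, `A·S·A ⊆ A`, and `(A] = A`. -/
def IsBiIdeal [Semigroup S] [LE S] (A : Set S) : Prop :=
  A.Nonempty ∧ (∀ a ∈ A, ∀ s : S, ∀ b ∈ A, a * s * b ∈ A) ∧ dcl A = A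

/-- A right ideal: nonempty, `R·S ⊆ R`, `(R] = R`. -/
def IsRightIdeal [Semigroup S] [LE S] (R : Set S) : Prop :=
  R.Nonempty ∧ (∀ r ∈ R, ∀ s : S, r * s ∈ R) ∧ dcl R = R

/-- A left ideal: nonempty, `S·L ⊆ L`, `(L] = L`. -/
def IsLeftIdeal [Semigroup S] [LE S] (L : Set S) : Prop :=
  L.Nonempty ∧ (∀ l ∈ L, ∀ s : S, s * l ∈ L) ∧ dcl L = L

/-- Principal left ideal `L(a) = ({a} ∪ Sa]`. -/
def Lp [Semigroup S] [LE S] (a : S) : Set S :=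
  dcl (({a} : Set S) ∪ Set.range (fun s => s * a))

/-- Principal right ideal `R(a) = ({a} ∪ aS]`. -/
def Rp [Semigroup S] [LE S] (a : S) : Set S :=
  dcl (({a} : Set S) ∪ Set.range (fun s => a * s))

theorem dcl_range_mul_subset [Semigroup S] [Preorder S] (hcomp : OrdCompat S) {a b x : S}
    (hab : a ≤ x * b) :
    dcl (Set.range (fun s : S => s * a)) ⊆ dcl (Set.range (fun s : S => s * b)) := by
  rintro z ⟨_, ⟨t, rfl⟩, hz⟩
  refine ⟨t * x * b, ⟨t * x, rfl⟩, hz.trans ?_⟩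
  rw [mul_assoc]
  exact (hcomp t _ _ hab).1

theorem dcl_range_mul_mono [Semigroup S] [Preorder S] (c b : S) :
    dcl (Set.range (fun s : S => s * (c * b))) ⊆ dcl (Set.range (fun s : S => s * b)) := by
  rintro z ⟨_, ⟨t, rfl⟩, hz⟩
  exact ⟨t * c * b, ⟨t * c, rfl⟩, by simpa only [mul_assoc] using hz⟩

/-- If `A = (XB]` and `B = (YA]` with `A` a bi-ideal of a regular ordered semigroup, then every
element of `A` generates the same left ideal as some element of `B`. -/
theorem exists_dcl_range_mul_eq [Semigroup S] [Preorder S] (hcomp : OrdCompat S)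
    (hreg : ∀ a : S, ∃ x : S, a ≤ a * x * a) {A B X Y : Set S} (hA : IsBiIdeal A)
    (hAX : A = dcl (setMul X B)) (hBY : B = dcl (setMul Y A)) {a : S} (ha : a ∈ A) :
    ∃ b ∈ B,
      dcl (Set.range (fun s : S => s * a)) = dcl (Set.range (fun s : S => s * b)) := by
  obtain ⟨s, hs⟩ := hreg a
  obtain ⟨_, ⟨x, -, b, hb, rfl⟩, hab⟩ := hAX.subset ha
  obtain ⟨_, ⟨y, hy, a', ha', rfl⟩, hba⟩ := hBY.subset hb
  refine ⟨b * s * a, hBY.symm.subset ⟨y * (a' * s * a),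
    ⟨y, hy, _, hA.2.1 a' ha' s a ha, rfl⟩, ?_⟩, ?_⟩
  · simpa only [mul_assoc] using (hcomp (s * a) _ _ hba).2
  · refine (dcl_range_mul_subset hcomp (x := x) ?_).antisymm (dcl_range_mul_mono (b * s) a)
    refine hs.trans ?_
    simpa only [mul_assoc] using (hcomp (s * a) _ _ hab).2

theorem stmt_4 [Semigroup S] [PartialOrder S] (hcomp : OrdCompat S)
    (hreg : ∀ a : S, ∃ x : S, a ≤ a * x * a)
    (A B : Set S) (hA : IsBiIdeal A) (hB : IsBiIdeal B)
    (h : ∃ X Y : Set S, IsBiIdeal X ∧ IsBiIdeal Y ∧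
      A = dcl (setMul X B) ∧ B = dcl (setMul Y A)) :
    (∀ a ∈ A, ∃ b ∈ B,
      dcl (Set.range (fun s : S => s * a)) = dcl (Set.range (fun s : S => s * b))) ∧
    (∀ b ∈ B, ∃ a ∈ A,
      dcl (Set.range (fun s : S => s * a)) = dcl (Set.range (fun s : S => s * b))) := by
  obtain ⟨X, Y, -, -, hAX, hBY⟩ := h
  refine ⟨fun a ha => exists_dcl_range_mul_eq hcomp hreg hA hAX hBY ha, fun b hb => ?_⟩
  obtain ⟨a, ha, hab⟩ := exists_dcl_range_mul_eq hcomp hreg hB hBY hAX hb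
  exact ⟨a, ha, hab.symm⟩
end

section
/- Let S be an ordered semigroup. Then S is both regular and intra-regular if and only if (AA] = A for every bi-ideal A of S (i.e. the semigroup of bi-ideals 𝓑(S), with product A∗B = (AB], is a band). -/
variable {S : Type*}

theorem OrdCompat.mul_le_mul [Semigroup S] [PartialOrder S] (hcomp : OrdCompat S)
    {a b c d : S} (h : a ≤ b) (h' : c ≤ d) : a * c ≤ b * d :=
  (hcomp c a b h).2.trans (hcomp b c d h').1

/-- The set `({a} ∪ aSa]` is a bi-ideal. -/
theorem isBiIdeal_dcl_principal [Semigroup S] [PartialOrder S] (hcomp : OrdCompat S) (a : S) :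
    IsBiIdeal (dcl (({a} : Set S) ∪ Set.range (fun s => a * s * a))) := by
  refine ⟨⟨a, a, Or.inl rfl, le_rfl⟩, ?_, ?_⟩
  · rintro u ⟨u', hu', hu⟩ s v ⟨v', hv', hv⟩
    refine ⟨u' * s * v', Or.inr ?_, hcomp.mul_le_mul (hcomp.mul_le_mul hu le_rfl) hv⟩
    rcases hu' with rfl | ⟨p, rfl⟩ <;> rcases hv' with hv' | ⟨q, rfl⟩
    · exact ⟨s, by rw [hv']⟩
    · exact ⟨s * u' * q, by simp only [mul_assoc]⟩
    · exact ⟨p * a * s, by rw [hv']; simp only [mul_assoc]⟩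
    · exact ⟨p * a * s * a * q, by simp only [mul_assoc]⟩
  · ext x
    constructor
    · rintro ⟨y, ⟨z, hz, hyz⟩, hxy⟩
      exact ⟨z, hz, hxy.trans hyz⟩
    · exact fun hx => ⟨x, hx, le_rfl⟩

theorem IsBiIdeal.dcl_setMul_self [Semigroup S] [PartialOrder S] (hcomp : OrdCompat S)
    (hreg : ∀ a : S, ∃ x : S, a ≤ a * x * a) (hintra : ∀ a : S, ∃ x y : S, a ≤ x * a * a * y)
    {A : Set S} (hA : IsBiIdeal A) : dcl (setMul A A) = A := by
  obtain ⟨-, hmul, hdcl⟩ := hA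
  ext a
  constructor
  · rintro ⟨_, ⟨u, hu, v, hv, rfl⟩, hle⟩
    obtain ⟨x, hx⟩ := hreg u
    rw [← hdcl]
    refine ⟨u * (x * u) * v, hmul u hu _ v hv, hle.trans ?_⟩
    simpa only [mul_assoc] using hcomp.mul_le_mul hx (le_refl v)
  · intro ha
    obtain ⟨x, hx⟩ := hreg a
    obtain ⟨p, q, hpq⟩ := hintra a
    refine ⟨_, ⟨_, hmul a ha (x * p) a ha, _, hmul a ha (q * x) a ha, rfl⟩, ?_⟩
    calc a ≤ a * x * a := hx
      _ ≤ a * x * (a * x * a) := hcomp.mul_le_mul le_rfl hx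
      _ ≤ a * x * (p * a * a * q * x * a) :=
        hcomp.mul_le_mul le_rfl
          (hcomp.mul_le_mul (hcomp.mul_le_mul hpq le_rfl) le_rfl)
      _ = a * (x * p) * a * (a * (q * x) * a) := by simp only [mul_assoc]

theorem stmt_8 [Semigroup S] [PartialOrder S] (hcomp : OrdCompat S) :
    ((∀ a : S, ∃ x : S, a ≤ a * x * a) ∧ (∀ a : S, ∃ x y : S, a ≤ x * a * a * y)) ↔
      ∀ A : Set S, IsBiIdeal A → dcl (setMul A A) = A := by
  refine ⟨fun h A hA => hA.dcl_setMul_self hcomp h.1 h.2, fun h => ?_⟩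
  rw [← forall_and]
  intro a
  have hmem : a ∈ dcl (({a} : Set S) ∪ Set.range (fun s => a * s * a)) :=
    ⟨a, Or.inl rfl, le_rfl⟩
  rw [← h _ (isBiIdeal_dcl_principal hcomp a)] at hmem
  obtain ⟨_, ⟨u, ⟨u', hu', hu⟩, v, ⟨v', hv', hv⟩, rfl⟩, hle⟩ := hmem
  replace hle : a ≤ u' * v' := hle.trans (hcomp.mul_le_mul hu hv)
  rcases hu' with rfl | ⟨p, rfl⟩ <;> rcases hv' with hv' | ⟨q, rfl⟩
  · subst hv'
    have hsq := hcomp.mul_le_mul hle hle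
    exact ⟨⟨v', hle.trans (hcomp.mul_le_mul hle le_rfl)⟩,
      v', v', hle.trans (by simpa only [mul_assoc] using hsq)⟩
  · refine ⟨⟨u' * q, by simpa only [mul_assoc] using hle⟩, u' * u' * q, q * u', hle.trans ?_⟩
    simpa only [mul_assoc] using
      hcomp.mul_le_mul hle (le_refl (u' * q * u'))
  · subst hv'
    refine ⟨⟨p * v', by simpa only [mul_assoc] using hle⟩, v' * p, p * v' * v', hle.trans ?_⟩
    simpa only [mul_assoc] using
      hcomp.mul_le_mul (le_refl (v' * p * v')) hle
  · exact ⟨⟨p * a * a * q, by simpa only [mul_assoc] using hle⟩,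
      a * p, q * a, by simpa only [mul_assoc] using hle⟩
end

section
/- Let X be a nonempty finite set and T_X the full transformation semigroup on X with multiplication (f∗g)(x) = g(f(x)), ordered by the natural partial order: f ≤ g iff f∗T_X ⊆ g∗T_X and there exists α ∈ T_X with f = α∗f and f = α∗g. Then for f, g ∈ T_X, the principal right ideals in (T_X, ≤) coincide, i.e. ({f} ∪ f∗T_X] = ({g} ∪ g∗T_X], if and only if f and g are Green's 𝓡-related in the plain semigroup T_X, i.e. f and g have the same kernel: for all x, y ∈ X, f(x) = f(y) ⟺ g(x) = g(y). -/
variable {X : Type*}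

/-- Multiplication of the full transformation semigroup: `(f∗g)(x) = g (f x)`. -/
def tmul (f g : X → X) : X → X := fun x => g (f x)

/-- The natural partial order on the full transformation semigroup:
`f ≤ g` iff `f∗T_X ⊆ g∗T_X` and there is `α` with `f = α∗f = α∗g`. -/
def tle (f g : X → X) : Prop :=
  Set.range (tmul f) ⊆ Set.range (tmul g) ∧ ∃ α : X → X, f = tmul α f ∧ f = tmul α g

/-- Downward closure with respect to the natural partial order. -/
def tdcl (A : Set (X → X)) : Set (X → X) := {t | ∃ a ∈ A, tle t a}

theorem mem_range_tmul_iff [Nonempty X] (f t : X → X) :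
    t ∈ Set.range (tmul f) ↔ ∀ x y, f x = f y → t x = t y := by
  constructor
  · rintro ⟨h, rfl⟩ x y hxy
    exact congrArg h hxy
  · intro ht
    have hft : Function.FactorsThrough t f := fun x y hxy => ht x y hxy
    obtain ⟨h, hh⟩ := (Function.factorsThrough_iff t).1 hft
    exact ⟨h, hh.symm⟩

theorem self_mem_range_tmul (f : X → X) : f ∈ Set.range (tmul f) := ⟨id, rfl⟩

theorem range_tmul_subset {f a : X → X} (ha : a ∈ Set.range (tmul f)) :
    Set.range (tmul a) ⊆ Set.range (tmul f) := by
  obtain ⟨h, rfl⟩ := ha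
  rintro _ ⟨k, rfl⟩
  exact ⟨k ∘ h, rfl⟩

theorem tdcl_principal (f : X → X) :
    tdcl (({f} : Set (X → X)) ∪ Set.range (tmul f)) = Set.range (tmul f) := by
  rw [Set.union_eq_self_of_subset_left (Set.singleton_subset_iff.2 (self_mem_range_tmul f))]
  ext t
  constructor
  · rintro ⟨a, ha, hta, -⟩
    exact range_tmul_subset ha (hta (self_mem_range_tmul t))
  · intro ht
    exact ⟨t, ht, subset_rfl, id, rfl, rfl⟩

theorem stmt_17 (X : Type*) [Finite X] [Nonempty X] (f g : X → X) :
    tdcl (({f} : Set (X → X)) ∪ Set.range (tmul f)) =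
        tdcl (({g} : Set (X → X)) ∪ Set.range (tmul g)) ↔
      ∀ x y : X, f x = f y ↔ g x = g y := by
  rw [tdcl_principal, tdcl_principal]
  constructor
  · intro h x y
    exact ⟨(mem_range_tmul_iff f g).1 (h ▸ self_mem_range_tmul g) x y,
      (mem_range_tmul_iff g f).1 (h ▸ self_mem_range_tmul f) x y⟩
  · intro h
    ext t
    simp only [mem_range_tmul_iff, h]
end

section
/- Let X be a nonempty finite set and T_X the full transformation semigroup on X with multiplication (f∗g)(x) = g(f(x)), ordered by the natural partial order: f ≤ g iff f∗T_X ⊆ g∗T_X and there exists α ∈ T_X with f = α∗f and f = α∗g. For f ∈ T_X let B(f) = ({f} ∪ {f∗h∗f : h ∈ T_X}] be the principal bi-ideal generated by f. Then for f, g ∈ T_X the following are equivalent: (i) f(X) = g(X); (ii) for every t ∈ B(f) there exists s ∈ B(g) with t(X) = s(X), and for every s ∈ B(g) there exists t ∈ B(f) with t(X) = s(X). -/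
variable {X : Type*}

theorem tle_refl (f : X → X) : tle f f :=
  ⟨subset_rfl, id, rfl, rfl⟩

theorem range_subset_of_tle {f g : X → X} (h : tle f g) : Set.range f ⊆ Set.range g := by
  obtain ⟨-, α, -, hα⟩ := h
  rw [hα]
  exact Set.range_comp_subset_range α g

theorem mem_tdcl_biideal (f : X → X) :
    f ∈ tdcl (({f} : Set (X → X)) ∪ Set.range (fun h : X → X => tmul (tmul f h) f)) :=
  ⟨f, Or.inl rfl, tle_refl f⟩

/-- Every element of the principal bi-ideal generated by `f` has its range inside that of `f`. -/
theorem range_subset_of_mem_tdcl_biideal {f t : X → X}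
    (ht : t ∈ tdcl (({f} : Set (X → X)) ∪ Set.range (fun h : X → X => tmul (tmul f h) f))) :
    Set.range t ⊆ Set.range f := by
  obtain ⟨a, rfl | ⟨h, rfl⟩, hta⟩ := ht
  · exact range_subset_of_tle hta
  · exact (range_subset_of_tle hta).trans (Set.range_comp_subset_range (tmul f h) f)

/-- Every nonempty subset of the range of `g` is the range of some map below `g`. -/
theorem exists_tle_range_eq (g : X → X) {A : Set X} (hA : A.Nonempty) (hAg : A ⊆ Set.range g) :
    ∃ s, tle s g ∧ Set.range s = A := by
  classical
  obtain ⟨a, ha⟩ := hA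
  let k : X → X := fun x => if x ∈ A then x else a
  have hk : ∀ x, k x ∈ A := fun x => by
    by_cases hx : x ∈ A <;> simp [k, hx, ha]
  have hk_of_mem : ∀ x ∈ A, k x = x := fun x hx => if_pos hx
  choose p hp using fun x => hAg (hk x)
  refine ⟨fun x => k (g x), ⟨?_, fun x => p (g x), ?_, ?_⟩, ?_⟩
  · rintro _ ⟨h, rfl⟩
    exact ⟨fun x => h (k x), rfl⟩
  · funext x
    simp only [tmul, hp, hk_of_mem _ (hk _)]
  · funext x
    simp only [tmul, hp]
  · ext y
    constructor
    · rintro ⟨x, rfl⟩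
      exact hk _
    · intro hy
      obtain ⟨x, rfl⟩ := hAg hy
      exact ⟨x, hk_of_mem _ hy⟩

theorem exists_mem_tdcl_biideal_range_eq [Nonempty X] {f g t : X → X}
    (hfg : Set.range f ⊆ Set.range g)
    (ht : t ∈ tdcl (({f} : Set (X → X)) ∪ Set.range (fun h : X → X => tmul (tmul f h) f))) :
    ∃ s ∈ tdcl (({g} : Set (X → X)) ∪ Set.range (fun h : X → X => tmul (tmul g h) g)),
      Set.range t = Set.range s := by
  obtain ⟨s, hs, hst⟩ := exists_tle_range_eq g (Set.range_nonempty t)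
    ((range_subset_of_mem_tdcl_biideal ht).trans hfg)
  exact ⟨s, ⟨g, Or.inl rfl, hs⟩, hst.symm⟩

theorem stmt_18 (X : Type*) [Finite X] [Nonempty X] (f g : X → X) :
    Set.range f = Set.range g ↔
      ((∀ t ∈ tdcl (({f} : Set (X → X)) ∪ Set.range (fun h : X → X => tmul (tmul f h) f)),
          ∃ s ∈ tdcl (({g} : Set (X → X)) ∪ Set.range (fun h : X → X => tmul (tmul g h) g)),
            Set.range t = Set.range s) ∧
       (∀ s ∈ tdcl (({g} : Set (X → X)) ∪ Set.range (fun h : X → X => tmul (tmul g h) g)),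
          ∃ t ∈ tdcl (({f} : Set (X → X)) ∪ Set.range (fun h : X → X => tmul (tmul f h) f)),
            Set.range t = Set.range s)) := by
  constructor
  · intro h
    refine ⟨fun t ht => exists_mem_tdcl_biideal_range_eq h.subset ht, fun s hs => ?_⟩
    obtain ⟨t, ht, hst⟩ := exists_mem_tdcl_biideal_range_eq h.symm.subset hs
    exact ⟨t, ht, hst.symm⟩
  · rintro ⟨hf, hg⟩
    obtain ⟨s, hs, hfs⟩ := hf f (mem_tdcl_biideal f)
    obtain ⟨t, ht, htg⟩ := hg g (mem_tdcl_biideal g)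
    apply Set.Subset.antisymm
    · exact hfs ▸ range_subset_of_mem_tdcl_biideal hs
    · exact htg ▸ range_subset_of_mem_tdcl_biideal ht
end
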